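/- arXiv:1301.3330 — 2 statements merged into one kernel-verified Lean document; each statement's English description precedes it below -/
import Mathlib

section
/- Let V be a 3-dimensional real vector space and let ρ ∈ Λ(V*) be a non-null spinor, i.e., ⟨ρ,ρ⟩ ≠ 0 in Λ³(V*). Then the annihilator of ρ under the Clifford action is trivial: if u = (X,ξ,λ) ∈ V × V* × ℝ satisfies u·ρ = ι_Xρ + ξ∧ρ + λτρ = 0, then u = 0. Equivalently, the linear map V × V* × ℝ → Λ(V*), u ↦ u·ρ, is injective. -/
set_option synthInstance.maxHeartbeats 1000000
set_option maxHeartbeats 1000000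

open Module ExteriorAlgebra

variable {V : Type*} [AddCommGroup V] [Module ℝ V]

/-- Projection onto the degree-`k` component of the exterior algebra `Λ(V*)`. -/
noncomputable def gproj (V : Type*) [AddCommGroup V] [Module ℝ V] (k : ℕ) :
    ExteriorAlgebra ℝ (Module.Dual ℝ V) →ₗ[ℝ] ExteriorAlgebra ℝ (Module.Dual ℝ V) :=
  GradedAlgebra.proj (fun i : ℕ => ⋀[ℝ]^i (Module.Dual ℝ V)) k

/-- The Chevalley pairing on `Λ(V*)` for a `3`-dimensional space `V`:
`⟨φ,ψ⟩ = φ₀ψ₃ + ψ₀φ₃ − φ₁∧ψ₂ − ψ₁∧φ₂`. -/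
noncomputable def chevPair (φ ψ : ExteriorAlgebra ℝ (Module.Dual ℝ V)) :
    ExteriorAlgebra ℝ (Module.Dual ℝ V) :=
  gproj V 0 φ * gproj V 3 ψ + gproj V 0 ψ * gproj V 3 φ
    - gproj V 1 φ * gproj V 2 ψ - gproj V 1 ψ * gproj V 2 φ

/-- The Clifford action of a generalized vector `u = (X,ξ,λ) ∈ V × V* × ℝ` on `Λ(V*)`:
`u·φ = ι_Xφ + ξ∧φ + λτφ`. -/
noncomputable def cliffAct (u : V × Module.Dual ℝ V × ℝ)
    (φ : ExteriorAlgebra ℝ (Module.Dual ℝ V)) : ExteriorAlgebra ℝ (Module.Dual ℝ V) :=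
  CliffordAlgebra.contractLeft (Module.Dual.eval ℝ V u.1) φ
    + ExteriorAlgebra.ι ℝ u.2.1 * φ
    + u.2.2 • CliffordAlgebra.involute φ

/-- The element of an algebra with coordinates `a, p, q, s` with respect to
`1`, `x, y, z`, `yz, zx, xy` (up to the sign convention `zx = -xz`) and `xyz`. -/
def triSum {A : Type*} [Ring A] [Algebra ℝ A] (x y z : A) (a p₁ p₂ p₃ q₁ q₂ q₃ s : ℝ) : A :=
  a • 1 + (p₁ • x + p₂ • y + p₃ • z) + (q₁ • (y * z) - q₂ • (x * z) + q₃ • (x * y))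
    + s • (x * (y * z))

section Anticommuting

variable {A : Type*} [Ring A] [Algebra ℝ A] {x y z : A}

theorem mul_triSum (hx : x * x = 0) (hy : y * y = 0) (hz : z * z = 0)
    (hyx : y * x = -(x * y)) (hzx : z * x = -(x * z)) (hzy : z * y = -(y * z))
    (f₁ f₂ f₃ a p₁ p₂ p₃ q₁ q₂ q₃ s : ℝ) :
    (f₁ • x + f₂ • y + f₃ • z) * triSum x y z a p₁ p₂ p₃ q₁ q₂ q₃ s =
      triSum x y z 0 (a * f₁) (a * f₂) (a * f₃)
        (f₂ * p₃ - f₃ * p₂) (f₃ * p₁ - f₁ * p₃) (f₁ * p₂ - f₂ * p₁)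
        (f₁ * q₁ + f₂ * q₂ + f₃ * q₃) := by
  have hx' (t : A) : x * (x * t) = 0 := by rw [← mul_assoc, hx, zero_mul]
  have hy' (t : A) : y * (y * t) = 0 := by rw [← mul_assoc, hy, zero_mul]
  have hyx' (t : A) : y * (x * t) = -(x * (y * t)) := by
    rw [← mul_assoc, hyx, neg_mul, mul_assoc]
  have hzx' (t : A) : z * (x * t) = -(x * (z * t)) := by
    rw [← mul_assoc, hzx, neg_mul, mul_assoc]
  have hzy' (t : A) : z * (y * t) = -(y * (z * t)) := by
    rw [← mul_assoc, hzy, neg_mul, mul_assoc]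
  simp only [triSum, mul_add, add_mul, mul_sub, smul_mul_assoc, mul_smul_comm, mul_one, hx, hy, hz,
    hyx, hzx, hzy, hx', hy', hyx', hzx', hzy', mul_neg, neg_neg, mul_zero, neg_zero, smul_zero]
  module

theorem triSum_add (a p₁ p₂ p₃ q₁ q₂ q₃ s a' p₁' p₂' p₃' q₁' q₂' q₃' s' : ℝ) :
    triSum x y z a p₁ p₂ p₃ q₁ q₂ q₃ s + triSum x y z a' p₁' p₂' p₃' q₁' q₂' q₃' s' =
      triSum x y z (a + a') (p₁ + p₁') (p₂ + p₂') (p₃ + p₃') (q₁ + q₁') (q₂ + q₂') (q₃ + q₃')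
        (s + s') := by
  simp only [triSum]
  module

theorem smul_triSum (c a p₁ p₂ p₃ q₁ q₂ q₃ s : ℝ) :
    c • triSum x y z a p₁ p₂ p₃ q₁ q₂ q₃ s =
      triSum x y z (c * a) (c * p₁) (c * p₂) (c * p₃) (c * q₁) (c * q₂) (c * q₃) (c * s) := by
  simp only [triSum]
  module

theorem triSum_eq_zero (hx : x * x = 0) (hy : y * y = 0) (hz : z * z = 0)
    (hyx : y * x = -(x * y)) (hzx : z * x = -(x * z)) (hzy : z * y = -(y * z))
    (hne : x * (y * z) ≠ 0) {a p₁ p₂ p₃ q₁ q₂ q₃ s : ℝ}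
    (h : triSum x y z a p₁ p₂ p₃ q₁ q₂ q₃ s = 0) :
    a = 0 ∧ p₁ = 0 ∧ p₂ = 0 ∧ p₃ = 0 ∧ q₁ = 0 ∧ q₂ = 0 ∧ q₃ = 0 ∧ s = 0 := by
  have mulX (a p₁ p₂ p₃ q₁ q₂ q₃ s : ℝ) : x * triSum x y z a p₁ p₂ p₃ q₁ q₂ q₃ s =
      triSum x y z 0 a 0 0 0 (-p₃) p₂ q₁ := by
    simpa using mul_triSum hx hy hz hyx hzx hzy 1 0 0 a p₁ p₂ p₃ q₁ q₂ q₃ s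
  have mulY (a p₁ p₂ p₃ q₁ q₂ q₃ s : ℝ) : y * triSum x y z a p₁ p₂ p₃ q₁ q₂ q₃ s =
      triSum x y z 0 0 a 0 p₃ 0 (-p₁) q₂ := by
    simpa using mul_triSum hx hy hz hyx hzx hzy 0 1 0 a p₁ p₂ p₃ q₁ q₂ q₃ s
  have mulZ (a p₁ p₂ p₃ q₁ q₂ q₃ s : ℝ) : z * triSum x y z a p₁ p₂ p₃ q₁ q₂ q₃ s =
      triSum x y z 0 0 0 a (-p₂) p₁ 0 q₃ := by
    simpa using mul_triSum hx hy hz hyx hzx hzy 0 0 1 a p₁ p₂ p₃ q₁ q₂ q₃ s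
  have top {c : ℝ} (hc : triSum x y z 0 0 0 0 0 0 0 c = 0) : c = 0 := by
    simpa [triSum, hne] using hc
  have ha : a = 0 := top <| by
    have := congrArg (fun t => x * (y * (z * t))) h
    simpa [mulX, mulY, mulZ] using this
  subst ha
  have hp₁ : p₁ = 0 := top <| by
    have := congrArg (fun t => y * (z * t)) h
    simpa [mulX, mulY, mulZ] using this
  have hp₂ : p₂ = 0 := top <| by
    have := congrArg (fun t => z * (x * t)) h
    simpa [mulX, mulY, mulZ] using this
  have hp₃ : p₃ = 0 := top <| by
    have := congrArg (fun t => x * (y * t)) h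
    simpa [mulX, mulY, mulZ] using this
  subst hp₁ hp₂ hp₃
  have hq₁ : q₁ = 0 := top <| by
    have := congrArg (fun t => x * t) h
    simpa [mulX] using this
  have hq₂ : q₂ = 0 := top <| by
    have := congrArg (fun t => y * t) h
    simpa [mulY] using this
  have hq₃ : q₃ = 0 := top <| by
    have := congrArg (fun t => z * t) h
    simpa [mulZ] using this
  subst hq₁ hq₂ hq₃
  exact ⟨rfl, rfl, rfl, rfl, rfl, rfl, rfl, top h⟩

end Anticommuting

theorem ι_mul_ι_swap (f g : Module.Dual ℝ V) : ι ℝ g * ι ℝ f = -(ι ℝ f * ι ℝ g) :=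
  eq_neg_of_add_eq_zero_left (ι_add_mul_swap g f)

theorem ι_mul_triSum (e : Fin 3 → Module.Dual ℝ V) (f₁ f₂ f₃ a p₁ p₂ p₃ q₁ q₂ q₃ s : ℝ) :
    ι ℝ (f₁ • e 0 + f₂ • e 1 + f₃ • e 2) *
      triSum (ι ℝ (e 0)) (ι ℝ (e 1)) (ι ℝ (e 2)) a p₁ p₂ p₃ q₁ q₂ q₃ s =
      triSum (ι ℝ (e 0)) (ι ℝ (e 1)) (ι ℝ (e 2)) 0 (a * f₁) (a * f₂) (a * f₃)
        (f₂ * p₃ - f₃ * p₂) (f₃ * p₁ - f₁ * p₃) (f₁ * p₂ - f₂ * p₁)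
        (f₁ * q₁ + f₂ * q₂ + f₃ * q₃) := by
  rw [map_add, map_add, map_smul, map_smul, map_smul]
  exact mul_triSum (ι_sq_zero _) (ι_sq_zero _) (ι_sq_zero _)
    (ι_mul_ι_swap _ _) (ι_mul_ι_swap _ _) (ι_mul_ι_swap _ _) ..

theorem exists_eq_triSum (e : Basis (Fin 3) ℝ (Module.Dual ℝ V))
    (φ : ExteriorAlgebra ℝ (Module.Dual ℝ V)) :
    ∃ a p₁ p₂ p₃ q₁ q₂ q₃ s,
      φ = triSum (ι ℝ (e 0)) (ι ℝ (e 1)) (ι ℝ (e 2)) a p₁ p₂ p₃ q₁ q₂ q₃ s := by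
  induction φ using CliffordAlgebra.left_induction with
  | algebraMap r =>
    refine ⟨r, 0, 0, 0, 0, 0, 0, 0, ?_⟩
    simp [triSum, Algebra.algebraMap_eq_smul_one]
  | add φ ψ hφ hψ =>
    obtain ⟨a, p₁, p₂, p₃, q₁, q₂, q₃, s, rfl⟩ := hφ
    obtain ⟨a', p₁', p₂', p₃', q₁', q₂', q₃', s', rfl⟩ := hψ
    exact ⟨_, _, _, _, _, _, _, _, triSum_add ..⟩
  | ι_mul φ f hφ =>
    obtain ⟨a, p₁, p₂, p₃, q₁, q₂, q₃, s, rfl⟩ := hφ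
    rw [← e.sum_repr f, Fin.sum_univ_three]
    exact ⟨_, _, _, _, _, _, _, _, ι_mul_triSum ..⟩

theorem contractLeft_triSum (d : Module.Dual ℝ (Module.Dual ℝ V)) (e : Fin 3 → Module.Dual ℝ V)
    (a p₁ p₂ p₃ q₁ q₂ q₃ s : ℝ) :
    CliffordAlgebra.contractLeft d
      (triSum (ι ℝ (e 0)) (ι ℝ (e 1)) (ι ℝ (e 2)) a p₁ p₂ p₃ q₁ q₂ q₃ s) =
      triSum (ι ℝ (e 0)) (ι ℝ (e 1)) (ι ℝ (e 2))
        (p₁ * d (e 0) + p₂ * d (e 1) + p₃ * d (e 2))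
        (q₂ * d (e 2) - q₃ * d (e 1)) (q₃ * d (e 0) - q₁ * d (e 2)) (q₁ * d (e 1) - q₂ * d (e 0))
        (s * d (e 0)) (s * d (e 1)) (s * d (e 2)) 0 := by
  simp only [triSum, map_add, map_sub, map_smul, CliffordAlgebra.contractLeft_ι_mul,
    CliffordAlgebra.contractLeft_ι, CliffordAlgebra.contractLeft_one,
    Algebra.algebraMap_eq_smul_one, mul_sub, mul_smul_comm, mul_one]
  module

theorem involute_triSum (e : Fin 3 → Module.Dual ℝ V) (a p₁ p₂ p₃ q₁ q₂ q₃ s : ℝ) :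
    CliffordAlgebra.involute
      (triSum (ι ℝ (e 0)) (ι ℝ (e 1)) (ι ℝ (e 2)) a p₁ p₂ p₃ q₁ q₂ q₃ s) =
      triSum (ι ℝ (e 0)) (ι ℝ (e 1)) (ι ℝ (e 2)) a (-p₁) (-p₂) (-p₃) q₁ q₂ q₃ (-s) := by
  simp only [triSum, map_add, map_sub, map_smul, map_mul, map_one, CliffordAlgebra.involute_ι,
    neg_mul, mul_neg, neg_neg]
  module

theorem gproj_of_mem {k i : ℕ} {φ : ExteriorAlgebra ℝ (Module.Dual ℝ V)}
    (hφ : φ ∈ ⋀[ℝ]^i (Module.Dual ℝ V)) : gproj V k φ = if k = i then φ else 0 := by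
  rw [gproj, GradedAlgebra.proj_apply]
  split_ifs with h
  · subst h
    exact DirectSum.decompose_of_mem_same _ hφ
  · exact DirectSum.decompose_of_mem_ne _ hφ (Ne.symm h)

theorem gproj_triSum (k : ℕ) (e : Fin 3 → Module.Dual ℝ V) (a p₁ p₂ p₃ q₁ q₂ q₃ s : ℝ) :
    gproj V k (triSum (ι ℝ (e 0)) (ι ℝ (e 1)) (ι ℝ (e 2)) a p₁ p₂ p₃ q₁ q₂ q₃ s) =
      triSum (ι ℝ (e 0)) (ι ℝ (e 1)) (ι ℝ (e 2)) (if k = 0 then a else 0)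
        (if k = 1 then p₁ else 0) (if k = 1 then p₂ else 0) (if k = 1 then p₃ else 0)
        (if k = 2 then q₁ else 0) (if k = 2 then q₂ else 0) (if k = 2 then q₃ else 0)
        (if k = 3 then s else 0) := by
  have h0 : (1 : ExteriorAlgebra ℝ (Module.Dual ℝ V)) ∈ ⋀[ℝ]^0 (Module.Dual ℝ V) :=
    SetLike.GradedOne.one_mem
  have h1 (f : Module.Dual ℝ V) : ι ℝ f ∈ ⋀[ℝ]^1 (Module.Dual ℝ V) := by
    simp [exteriorPower]
  have h2 (f g : Module.Dual ℝ V) : ι ℝ f * ι ℝ g ∈ ⋀[ℝ]^2 (Module.Dual ℝ V) :=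
    SetLike.GradedMul.mul_mem (h1 f) (h1 g)
  have h3 (f g h : Module.Dual ℝ V) : ι ℝ f * (ι ℝ g * ι ℝ h) ∈ ⋀[ℝ]^3 (Module.Dual ℝ V) :=
    SetLike.GradedMul.mul_mem (h1 f) (h2 g h)
  simp only [triSum, map_add, map_sub, map_smul, gproj_of_mem h0, gproj_of_mem (h1 _),
    gproj_of_mem (h2 _ _), gproj_of_mem (h3 _ _ _), smul_ite, ite_smul, smul_zero, zero_smul]

theorem chevPair_triSum_self (e : Fin 3 → Module.Dual ℝ V) (a p₁ p₂ p₃ q₁ q₂ q₃ s : ℝ) :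
    chevPair (triSum (ι ℝ (e 0)) (ι ℝ (e 1)) (ι ℝ (e 2)) a p₁ p₂ p₃ q₁ q₂ q₃ s)
      (triSum (ι ℝ (e 0)) (ι ℝ (e 1)) (ι ℝ (e 2)) a p₁ p₂ p₃ q₁ q₂ q₃ s) =
      (2 * (a * s - (p₁ * q₁ + p₂ * q₂ + p₃ * q₃))) • (ι ℝ (e 0) * (ι ℝ (e 1) * ι ℝ (e 2))) := by
  have h := ι_mul_triSum e p₁ p₂ p₃ 0 0 0 0 q₁ q₂ q₃ 0
  rw [map_add, map_add, map_smul, map_smul, map_smul] at h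
  simp only [triSum, zero_smul, zero_add, add_zero, mul_zero, zero_mul, sub_self] at h
  simp only [chevPair, gproj_triSum]
  simp [triSum, h]
  module

/-- On a `3`-dimensional space, a non-null spinor `ρ` (`⟨ρ,ρ⟩ ≠ 0`) has trivial
annihilator under the Clifford action: `u·ρ = 0` implies `u = 0`; equivalently, the
linear map `u ↦ u·ρ` from `V × V* × ℝ` to `Λ(V*)` is injective. -/
theorem cliffAct_annihilator_trivial [FiniteDimensional ℝ V]
    (h3 : Module.finrank ℝ V = 3)
    (ρ : ExteriorAlgebra ℝ (Module.Dual ℝ V)) (hρ : chevPair ρ ρ ≠ 0) :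
    (∀ u : V × Module.Dual ℝ V × ℝ, cliffAct u ρ = 0 → u = 0) ∧
    Function.Injective (fun u : V × Module.Dual ℝ V × ℝ => cliffAct u ρ) := by
  have inj_zero : ∀ u : V × Module.Dual ℝ V × ℝ, cliffAct u ρ = 0 → u = 0 := by
    rintro ⟨X, ξ, l⟩ hu
    let b : Basis (Fin 3) ℝ V := finBasisOfFinrankEq ℝ V h3
    let e : Basis (Fin 3) ℝ (Module.Dual ℝ V) := b.dualBasis
    obtain ⟨a, p₁, p₂, p₃, q₁, q₂, q₃, s, rfl⟩ := exists_eq_triSum e ρ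
    rw [chevPair_triSum_self] at hρ
    have hvol := right_ne_zero_of_smul hρ
    have hN : a * s - (p₁ * q₁ + p₂ * q₂ + p₃ * q₃) ≠ 0 :=
      right_ne_zero_of_mul (left_ne_zero_of_smul hρ)
    have hξ : ξ = e.repr ξ 0 • e 0 + e.repr ξ 1 • e 1 + e.repr ξ 2 • e 2 := by
      rw [← Fin.sum_univ_three (fun i => e.repr ξ i • e i), e.sum_repr]
    have hX (i : Fin 3) : Module.Dual.eval ℝ V X (e i) = b.repr X i := by
      simp [e, Module.Dual.eval_apply]
    simp only [cliffAct] at hu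
    rw [hξ, contractLeft_triSum, ι_mul_triSum, involute_triSum, smul_triSum, triSum_add,
      triSum_add, hX, hX, hX] at hu
    obtain ⟨h0, h11, h12, h13, h21, h22, h23, h3⟩ :=
      triSum_eq_zero (ι_sq_zero _) (ι_sq_zero _) (ι_sq_zero _)
        (ι_mul_ι_swap _ _) (ι_mul_ι_swap _ _) (ι_mul_ι_swap _ _) hvol hu
    generalize hx₁ : b.repr X 0 = x₁ at *
    generalize hx₂ : b.repr X 1 = x₂ at *
    generalize hx₃ : b.repr X 2 = x₃ at *
    generalize hf₁ : e.repr ξ 0 = f₁ at *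
    generalize hf₂ : e.repr ξ 1 = f₂ at *
    generalize hf₃ : e.repr ξ 2 = f₃ at *
    have hl : l = 0 := (mul_eq_zero.mp (by
      linear_combination s * h0 - p₁ * h21 - p₂ * h22 - p₃ * h23 :
        (a * s - (p₁ * q₁ + p₂ * q₂ + p₃ * q₃)) * l = 0)).resolve_left hN
    subst hl
    have cancel {c : ℝ} (hc : (a * s - (p₁ * q₁ + p₂ * q₂ + p₃ * q₃)) * c = 0) : c = 0 :=
      (mul_eq_zero.mp hc).resolve_left hN
    have kx₁ : x₁ = 0 := cancel (by
      linear_combination a * h21 + p₂ * h13 - p₃ * h12 - q₁ * h0)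
    have kx₂ : x₂ = 0 := cancel (by
      linear_combination a * h22 + p₃ * h11 - p₁ * h13 - q₂ * h0)
    have kx₃ : x₃ = 0 := cancel (by
      linear_combination a * h23 + p₁ * h12 - p₂ * h11 - q₃ * h0)
    have kf₁ : f₁ = 0 := cancel (by
      linear_combination s * h11 - q₂ * h23 + q₃ * h22 - p₁ * h3)
    have kf₂ : f₂ = 0 := cancel (by
      linear_combination s * h12 - q₃ * h21 + q₁ * h23 - p₂ * h3)
    have kf₃ : f₃ = 0 := cancel (by
      linear_combination s * h13 - q₁ * h22 + q₂ * h21 - p₃ * h3)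
    have kX : X = 0 := b.ext_elem fun i => by
      fin_cases i <;> simp [hx₁, hx₂, hx₃, kx₁, kx₂, kx₃]
    have kξ : ξ = 0 := by rw [hξ, kf₁, kf₂, kf₃]; simp
    rw [kX, kξ]
    rfl
  refine ⟨inj_zero, fun u v huv => sub_eq_zero.mp (inj_zero _ ?_)⟩
  have huv : cliffAct u ρ = cliffAct v ρ := huv
  rw [← sub_eq_zero] at huv
  rw [← huv]
  simp only [cliffAct, Prod.fst_sub, Prod.snd_sub, map_sub, LinearMap.sub_apply, sub_mul, sub_smul]
  abel
end

section
/- Let V be a 3-dimensional real vector space, B ∈ Λ²(V*) and A ∈ V*. The spin action σ(B,A)(φ) = (φ − A∧τφ) − B∧(φ − A∧τφ) on Λ(V*) is equivariant over the orthogonal transformation e(B,A) of W = V × V* × ℝ: for every generalized vector u ∈ W and every φ ∈ Λ(V*), (e(B,A)u)·(σ(B,A)φ) = σ(B,A)(u·φ), where e(B,A)(X,ξ,λ) = (X, ξ + B(X,·) − 2λA − A(X)·A, λ + A(X)). -/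
set_option synthInstance.maxHeartbeats 1000000
set_option maxHeartbeats 1000000

open Module ExteriorAlgebra

variable {V : Type*} [AddCommGroup V] [Module ℝ V]

/-- For `B ∈ Λ²(V*) ⊂ Λ(V*)` and `X ∈ V`, the `1`-form `B(X,·) : Y ↦ B(X,Y)`,
obtained by contracting `B` with `X` and then evaluating against `Y`. -/
noncomputable def formOfTwo (B : ExteriorAlgebra ℝ (Module.Dual ℝ V)) (X : V) :
    Module.Dual ℝ V :=
  (ExteriorAlgebra.algebraMapInv).toLinearMap ∘ₗ
    ((CliffordAlgebra.contractLeft (Q := (0 : QuadraticForm ℝ (Module.Dual ℝ V)))).flip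
        (CliffordAlgebra.contractLeft (Module.Dual.eval ℝ V X) B)) ∘ₗ
    Module.Dual.eval ℝ V

/-- The action of the `(B+A)`-field on `W = V × V* × ℝ`:
`e(B,A)(X,ξ,λ) = (X, ξ + B(X,·) − 2λA − A(X)·A, λ + A(X))`, for `B ∈ Λ²(V*)`. -/
noncomputable def eBAvec (B : ExteriorAlgebra ℝ (Module.Dual ℝ V))
    (A : Module.Dual ℝ V) (u : V × Module.Dual ℝ V × ℝ) : V × Module.Dual ℝ V × ℝ :=
  (u.1, u.2.1 + formOfTwo B u.1 - (2 * u.2.2) • A - (A u.1) • A, u.2.2 + A u.1)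

/-- The spin action of the `(B+A)`-field on spinors:
`σ(B,A)(φ) = (φ − A∧τφ) − B∧(φ − A∧τφ)`. -/
noncomputable def spinBA (B : ExteriorAlgebra ℝ (Module.Dual ℝ V))
    (A : Module.Dual ℝ V) (φ : ExteriorAlgebra ℝ (Module.Dual ℝ V)) :
    ExteriorAlgebra ℝ (Module.Dual ℝ V) :=
  (φ - ExteriorAlgebra.ι ℝ A * CliffordAlgebra.involute φ)
    - B * (φ - ExteriorAlgebra.ι ℝ A * CliffordAlgebra.involute φ)

section TwoForms

variable {M : Type*} [AddCommGroup M] [Module ℝ M] {B : ExteriorAlgebra ℝ M}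

@[elab_as_elim]
theorem exteriorPower_two_induction {p : ExteriorAlgebra ℝ M → Prop} (hB : B ∈ ⋀[ℝ]^2 M)
    (ι_mul_ι : ∀ a b : M, p (ι ℝ a * ι ℝ b)) (add : ∀ x y, p x → p y → p (x + y)) : p B := by
  rw [exteriorPower, pow_two] at hB
  induction hB using Submodule.mul_induction_on' with
  | mem_mul_mem x hx y hy =>
    obtain ⟨a, rfl⟩ := hx
    obtain ⟨b, rfl⟩ := hy
    exact ι_mul_ι a b
  | add x _ y _ hx hy => exact add x y hx hy

theorem ι_mul_eq_mul_ι_of_mem_exteriorPower_two (hB : B ∈ ⋀[ℝ]^2 M) (a : M) :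
    ι ℝ a * B = B * ι ℝ a := by
  refine exteriorPower_two_induction hB ?_ ?_
  · intro b c
    rw [← mul_assoc, eq_neg_of_add_eq_zero_left (ι_add_mul_swap a b), neg_mul, mul_assoc,
      eq_neg_of_add_eq_zero_left (ι_add_mul_swap a c), mul_neg, neg_neg, mul_assoc]
  · intro x y hx hy
    rw [mul_add, add_mul, hx, hy]

theorem involute_of_mem_exteriorPower_two (hB : B ∈ ⋀[ℝ]^2 M) :
    CliffordAlgebra.involute B = B := by
  refine exteriorPower_two_induction hB ?_ ?_
  · intro a b
    rw [map_mul]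
    exact (congrArg₂ (· * ·) (CliffordAlgebra.involute_ι a)
      (CliffordAlgebra.involute_ι b)).trans (neg_mul_neg _ _)
  · intro x y hx hy
    rw [map_add, hx, hy]

theorem contractLeft_mul_of_mem_exteriorPower_two (hB : B ∈ ⋀[ℝ]^2 M) (d : Module.Dual ℝ M)
    (ψ : ExteriorAlgebra ℝ M) :
    CliffordAlgebra.contractLeft d (B * ψ) =
      CliffordAlgebra.contractLeft d B * ψ + B * CliffordAlgebra.contractLeft d ψ := by
  have hι (a : M) (ψ : ExteriorAlgebra ℝ M) : CliffordAlgebra.contractLeft d (ι ℝ a * ψ) =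
      d a • ψ - ι ℝ a * CliffordAlgebra.contractLeft d ψ :=
    CliffordAlgebra.contractLeft_ι_mul d a ψ
  have hι' (a : M) : CliffordAlgebra.contractLeft d (ι ℝ a) = algebraMap ℝ _ (d a) :=
    CliffordAlgebra.contractLeft_ι 0 d a
  refine exteriorPower_two_induction hB ?_ ?_
  · intro a b
    simp only [mul_assoc, hι, hι', mul_sub, sub_mul, smul_mul_assoc, mul_smul_comm,
      ← Algebra.smul_def, ← Algebra.commutes (d b) (ι ℝ a)]
    abel
  · intro x y hx hy
    rw [add_mul, map_add, map_add, hx, hy]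
    noncomm_ring

theorem mul_self_eq_zero_of_mem_exteriorPower_two [FiniteDimensional ℝ M]
    (h : Module.finrank ℝ M ≤ 3) (hB : B ∈ ⋀[ℝ]^2 M) : B * B = 0 := by
  have hmem : B * B ∈ ⋀[ℝ]^4 M := by
    have := Submodule.mul_mem_mul hB hB
    rwa [exteriorPower, ← pow_add] at this
  have hbot : ⋀[ℝ]^4 M = ⊥ := by
    rw [← Submodule.finrank_eq_zero, exteriorPower.finrank_eq, Nat.choose_eq_zero_of_lt]
    lia
  rwa [hbot, Submodule.mem_bot] at hmem

theorem contractLeft_involute (d : Module.Dual ℝ M) (φ : ExteriorAlgebra ℝ M) :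
    CliffordAlgebra.contractLeft d (CliffordAlgebra.involute φ) =
      -CliffordAlgebra.involute (CliffordAlgebra.contractLeft d φ) := by
  induction φ using CliffordAlgebra.left_induction with
  | algebraMap r => simp
  | add x y hx hy => simp only [map_add, hx, hy, neg_add]
  | ι_mul x a hx =>
    simp only [map_mul, CliffordAlgebra.involute_ι, neg_mul, map_neg,
      CliffordAlgebra.contractLeft_ι_mul, hx, map_sub, map_smul]
    noncomm_ring

end TwoForms

theorem ι_formOfTwo {B : ExteriorAlgebra ℝ (Module.Dual ℝ V)}
    (hB : B ∈ ⋀[ℝ]^2 (Module.Dual ℝ V)) (X : V) :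
    ι ℝ (formOfTwo B X) = CliffordAlgebra.contractLeft (Module.Dual.eval ℝ V X) B := by
  have hι (d : Module.Dual ℝ (Module.Dual ℝ V)) (a : Module.Dual ℝ V) :
      CliffordAlgebra.contractLeft d (ι ℝ a) = algebraMap ℝ _ (d a) :=
    CliffordAlgebra.contractLeft_ι 0 d a
  refine exteriorPower_two_induction hB ?_ ?_
  · intro a b
    have h : CliffordAlgebra.contractLeft (Module.Dual.eval ℝ V X) (ι ℝ a * ι ℝ b) =
        ι ℝ (a X • b - b X • a) := by
      refine (CliffordAlgebra.contractLeft_ι_mul _ a _).trans ?_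
      rw [hι, ← Algebra.commutes, ← Algebra.smul_def, map_sub, map_smul, map_smul]
      rfl
    rw [h]
    congr 1
    ext Y
    simp only [formOfTwo, h, LinearMap.comp_apply, LinearMap.flip_apply, hι]
    exact algebraMap_leftInverse _ _
  · intro x y hx hy
    rw [map_add, ← hx, ← hy, ← map_add]
    congr 1
    ext Y
    simp [formOfTwo]

/-- On a `3`-dimensional space, the spin action `σ(B,A)` is equivariant over the
orthogonal transformation `e(B,A)` of `W = V × V* × ℝ`:
`(e(B,A)u)·(σ(B,A)φ) = σ(B,A)(u·φ)`. -/
theorem spinBA_equivariant [FiniteDimensional ℝ V] (h3 : Module.finrank ℝ V = 3)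
    (B : ExteriorAlgebra ℝ (Module.Dual ℝ V)) (hB : B ∈ ⋀[ℝ]^2 (Module.Dual ℝ V))
    (A : Module.Dual ℝ V)
    (u : V × Module.Dual ℝ V × ℝ) (φ : ExteriorAlgebra ℝ (Module.Dual ℝ V)) :
    cliffAct (eBAvec B A u) (spinBA B A φ) = spinBA B A (cliffAct u φ) := by
  obtain ⟨X, ξ, l⟩ := u
  set d := Module.Dual.eval ℝ V X with hd
  have hξ (ξ : Module.Dual ℝ V) (ψ) : ι ℝ ξ * (B * ψ) = B * (ι ℝ ξ * ψ) := by
    rw [← mul_assoc, ← mul_assoc, ι_mul_eq_mul_ι_of_mem_exteriorPower_two hB]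
  have hBB : B * B = 0 :=
    mul_self_eq_zero_of_mem_exteriorPower_two (Subspace.dual_finrank_eq.trans h3).le hB
  have hdB : CliffordAlgebra.contractLeft d B = ι ℝ (formOfTwo B X) := (ι_formOfTwo hB X).symm
  have hcB (ψ) : B * (ι ℝ (formOfTwo B X) * ψ) = 0 := by
    have h := contractLeft_mul_of_mem_exteriorPower_two hB d B
    rw [hBB, map_zero, hdB, ← ι_mul_eq_mul_ι_of_mem_exteriorPower_two hB,
      ← two_smul ℝ, eq_comm, smul_eq_zero_iff_right two_ne_zero] at h
    rw [← hξ, ← mul_assoc, h, zero_mul]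
  have hA (ψ) : ι ℝ A * (ι ℝ A * ψ) = 0 := by
    rw [← mul_assoc, ι_sq_zero, zero_mul]
  have hAξ (ψ) : ι ℝ A * (ι ℝ ξ * ψ) = -(ι ℝ ξ * (ι ℝ A * ψ)) := by
    rw [← mul_assoc, ← mul_assoc, ← neg_mul, eq_neg_of_add_eq_zero_left (ι_add_mul_swap A ξ)]
  have hdA : d A = A X := rfl
  have hι (a : Module.Dual ℝ V) (ψ) : CliffordAlgebra.contractLeft d (ι ℝ a * ψ) =
      d a • ψ - ι ℝ a * CliffordAlgebra.contractLeft d ψ :=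
    CliffordAlgebra.contractLeft_ι_mul d a ψ
  have hτ (a : Module.Dual ℝ V) :
      CliffordAlgebra.involute (ι ℝ a) = -ι ℝ a := CliffordAlgebra.involute_ι a
  simp only [cliffAct, eBAvec, spinBA, ← hd, map_sub, map_add, map_mul, map_smul,
    contractLeft_mul_of_mem_exteriorPower_two hB, hdB,
    involute_of_mem_exteriorPower_two hB, hι, hτ, contractLeft_involute,
    CliffordAlgebra.involute_involute, hdA, add_mul, sub_mul, mul_add, mul_sub, mul_neg,
    neg_mul, smul_mul_assoc, mul_smul_comm, hξ, hcB, hA, hAξ, mul_zero]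
  module
end
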